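/- arXiv:2602.19650 — 3 statements merged into one kernel-verified Lean document; each statement's English description precedes it below -/
import Mathlib

section
/- Let N ≥ 1 and define J_log : ℝ^N ∖ {0} → ℝ by J_log(z) = (4π)^{−N/2} ∫₀^∞ t^{−N/2 − 1} e^{−|z|²/(4t)} e^{−t} dt. Then lim_{z → 0, z ≠ 0} |z|^N J_log(z) = Γ(N/2)/π^{N/2}. -/
open MeasureTheory

/-- The Lévy kernel of the operator `log(I − Δ)`, obtained by integrating the
Gauss–Weierstrass heat kernel against the subordination density `e^{−t}/t`:
`J_log(z) = (4π)^{−N/2} ∫₀^∞ t^{−N/2 − 1} e^{−|z|²/(4t)} e^{−t} dt`. -/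
noncomputable def Jlog (N : ℕ) (z : EuclideanSpace ℝ (Fin N)) : ℝ :=
  (4 * Real.pi) ^ (-(N : ℝ) / 2) *
    ∫ t in Set.Ioi (0 : ℝ),
      t ^ (-(N : ℝ) / 2 - 1) * Real.exp (-‖z‖ ^ 2 / (4 * t)) * Real.exp (-t)

/-- The substitution `t = (r² / 4) / u` in the integral defining the kernel. -/
lemma pow_mul_integral_rpow_mul_exp_mul_exp (N : ℕ) {r : ℝ} (hr : 0 < r) :
    r ^ N * ((4 * Real.pi) ^ (-(N : ℝ) / 2) * ∫ t in Set.Ioi (0 : ℝ),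
      t ^ (-(N : ℝ) / 2 - 1) * Real.exp (-r ^ 2 / (4 * t)) * Real.exp (-t)) =
    (∫ u in Set.Ioi (0 : ℝ),
      Real.exp (-u) * u ^ ((N : ℝ) / 2 - 1) * Real.exp (-(r ^ 2 / 4 / u))) /
      Real.pi ^ ((N : ℝ) / 2) := by
  have ha : 0 < r ^ 2 / 4 := by positivity
  have hpow : (r ^ 2 / 4) ^ (-(N : ℝ) / 2) = (r ^ N)⁻¹ * 4 ^ ((N : ℝ) / 2) := by
    rw [Real.div_rpow (by positivity) (by norm_num), ← Real.rpow_natCast r 2,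
      ← Real.rpow_mul hr.le, neg_div, Real.rpow_neg (by norm_num : (0 : ℝ) ≤ 4), div_inv_eq_mul,
      ← Real.rpow_natCast r N, ← Real.rpow_neg hr.le]
    congr 2
    push_cast
    ring
  have hsubst : ∫ t in Set.Ioi (0 : ℝ),
      t ^ (-(N : ℝ) / 2 - 1) * Real.exp (-r ^ 2 / (4 * t)) * Real.exp (-t) =
      (r ^ 2 / 4) ^ (-(N : ℝ) / 2) * ∫ u in Set.Ioi (0 : ℝ),
        Real.exp (-u) * u ^ ((N : ℝ) / 2 - 1) * Real.exp (-(r ^ 2 / 4 / u)) := by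
    have hscale := integral_comp_mul_left_Ioi' (fun t : ℝ =>
      t ^ (-(N : ℝ) / 2 - 1) * Real.exp (-r ^ 2 / (4 * t)) * Real.exp (-t)) 0 ha
    rw [mul_zero, smul_eq_mul] at hscale
    rw [← hscale, ← integral_comp_rpow_Ioi _ (neg_ne_zero.mpr one_ne_zero),
      ← integral_const_mul, ← integral_const_mul]
    refine setIntegral_congr_fun measurableSet_Ioi fun u hu => ?_
    have hu : 0 < u := hu
    have hsq : u ^ (-1 - 1 : ℝ) = u⁻¹ * u⁻¹ := by
      rw [Real.rpow_sub hu, Real.rpow_neg_one, Real.rpow_one, div_eq_mul_inv]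
    have hexp : -r ^ 2 / (4 * (r ^ 2 / 4 * u⁻¹)) = -u := by
      field_simp
    have hneg : (u⁻¹) ^ (-(N : ℝ) / 2) = u ^ ((N : ℝ) / 2) := by
      rw [Real.inv_rpow hu.le, neg_div, Real.rpow_neg hu.le, inv_inv]
    simp only [smul_eq_mul, abs_neg, abs_one, one_mul, Real.rpow_neg_one, hexp, hsq]
    rw [Real.mul_rpow ha.le (inv_pos.mpr hu).le, Real.rpow_sub ha, Real.rpow_one,
      Real.rpow_sub (inv_pos.mpr hu), Real.rpow_one, hneg, Real.rpow_sub hu, Real.rpow_one,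
      div_eq_mul_inv _ u]
    field_simp
  rw [hsubst, hpow]
  generalize (∫ u in Set.Ioi (0 : ℝ),
    Real.exp (-u) * u ^ ((N : ℝ) / 2 - 1) * Real.exp (-(r ^ 2 / 4 / u))) = I
  rw [Real.mul_rpow (by norm_num) Real.pi_pos.le, neg_div,
    Real.rpow_neg (by norm_num), Real.rpow_neg Real.pi_pos.le]
  field_simp

/-- Damping the Gamma integral by `exp (-a / u)` has no effect in the limit `a → 0`. -/
lemma tendsto_integral_Gamma_mul_exp_neg_div {ι : Type*} {l : Filter ι} [l.IsCountablyGenerated]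
    {s : ℝ} (hs : 0 < s) {a : ι → ℝ} (ha : ∀ i, 0 ≤ a i) (hl : Filter.Tendsto a l (nhds 0)) :
    Filter.Tendsto (fun i => ∫ u in Set.Ioi (0 : ℝ),
      Real.exp (-u) * u ^ (s - 1) * Real.exp (-(a i / u))) l (nhds (Real.Gamma s)) := by
  rw [Real.Gamma_eq_integral hs]
  refine tendsto_integral_filter_of_dominated_convergence
    (fun u => Real.exp (-u) * u ^ (s - 1)) ?_ ?_ (Real.GammaIntegral_convergent hs) ?_
  · exact Filter.Eventually.of_forall fun i =>
      Measurable.aestronglyMeasurable (by fun_prop)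
  · refine Filter.Eventually.of_forall fun i => ?_
    filter_upwards [ae_restrict_mem measurableSet_Ioi] with u hu
    have hu : 0 < u := hu
    rw [Real.norm_of_nonneg (by positivity)]
    refine mul_le_of_le_one_right (by positivity) (Real.exp_le_one_iff.mpr ?_)
    exact neg_nonpos.mpr (div_nonneg (ha i) hu.le)
  · refine Filter.Eventually.of_forall fun u => ?_
    have h := ((hl.div_const u).neg.rexp).const_mul (Real.exp (-u) * u ^ (s - 1))
    simpa using h

/-- `lim_{z → 0, z ≠ 0} |z|^N J_log(z) = Γ(N/2)/π^{N/2}`. -/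
theorem tendsto_norm_pow_mul_Jlog_nhds_zero (N : ℕ) (hN : 1 ≤ N) :
    Filter.Tendsto (fun z : EuclideanSpace ℝ (Fin N) => ‖z‖ ^ N * Jlog N z)
      (nhdsWithin 0 {0}ᶜ)
      (nhds (Real.Gamma ((N : ℝ) / 2) / Real.pi ^ ((N : ℝ) / 2))) := by
  have hs : (0 : ℝ) < (N : ℝ) / 2 := by positivity
  have hnorm : Filter.Tendsto (fun z : EuclideanSpace ℝ (Fin N) => ‖z‖ ^ 2 / 4)
      (nhdsWithin 0 {0}ᶜ) (nhds 0) := by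
    have h : Continuous fun z : EuclideanSpace ℝ (Fin N) => ‖z‖ ^ 2 / 4 := by fun_prop
    simpa using (h.tendsto 0).mono_left nhdsWithin_le_nhds
  refine ((tendsto_integral_Gamma_mul_exp_neg_div hs (fun z => by positivity) hnorm).div_const
    (Real.pi ^ ((N : ℝ) / 2))).congr' ?_
  filter_upwards [self_mem_nhdsWithin] with z hz
  exact (pow_mul_integral_rpow_mul_exp_mul_exp N (norm_pos_iff.mpr hz)).symm
end

section
/- Let N ≥ 1 and define J_log : ℝ^N ∖ {0} → ℝ by J_log(z) = (4π)^{−N/2} ∫₀^∞ t^{−N/2 − 1} e^{−|z|²/(4t)} e^{−t} dt. Then lim_{|z| → ∞} |z|^{(N+1)/2} e^{|z|} J_log(z) = (2π)^{−(N−1)/2}. -/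
open MeasureTheory

open Filter Topology Set

/-- The scaled half-angle profile `h⁻¹ sinh (h u / 2)` dominates `u / 2` in absolute value. -/
lemma sq_div_four_le_sq_inv_mul_sinh {h : ℝ} (hh : 0 < h) (u : ℝ) :
    u ^ 2 / 4 ≤ (h⁻¹ * Real.sinh (h * u / 2)) ^ 2 := by
  have key : (h * u / 2) ^ 2 ≤ Real.sinh (h * u / 2) ^ 2 := by
    rw [sq_le_sq, Real.abs_sinh]
    exact Real.self_le_sinh_iff.2 (abs_nonneg _)
  calc u ^ 2 / 4 = h⁻¹ ^ 2 * (h * u / 2) ^ 2 := by field_simp; norm_num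
    _ ≤ h⁻¹ ^ 2 * Real.sinh (h * u / 2) ^ 2 := by gcongr
    _ = _ := by ring

lemma tendsto_inv_mul_sinh (u : ℝ) :
    Tendsto (fun h : ℝ => h⁻¹ * Real.sinh (h * u / 2)) (𝓝[>] 0) (𝓝 (u / 2)) := by
  have hd : HasDerivAt (fun h : ℝ => Real.sinh (h * u / 2)) (u / 2) 0 := by
    have := (((hasDerivAt_id (0 : ℝ)).mul_const u).div_const 2).sinh
    simpa using this
  simpa using hd.tendsto_slope_zero_right

/-- Laplace's method for the integral obtained from the Lévy kernel by the substitution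
`t = (r / 2) e^{h u}` with `h = r^{-1/2}`. -/
lemma tendsto_integral_exp_mul_exp_sinh (ν : ℝ) :
    Tendsto (fun h : ℝ => ∫ u : ℝ,
        Real.exp (-ν * (h * u)) * Real.exp (-2 * (h⁻¹ * Real.sinh (h * u / 2)) ^ 2))
      (𝓝[>] 0) (𝓝 (Real.sqrt (2 * Real.pi))) := by
  have hlim : ∫ u : ℝ, Real.exp (-(1 / 2) * u ^ 2) = Real.sqrt (2 * Real.pi) := by
    rw [integral_gaussian]
    congr 1
    ring
  rw [← hlim]
  refine tendsto_integral_filter_of_dominated_convergence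
    (fun u => Real.exp (ν ^ 2) * Real.exp (-(1 / 4) * u ^ 2)) ?_ ?_ ?_ ?_
  · exact Eventually.of_forall fun h => by
      apply Continuous.aestronglyMeasurable
      fun_prop
  · filter_upwards [Ioo_mem_nhdsGT (zero_lt_one' ℝ)] with h hh
    refine Eventually.of_forall fun u => ?_
    rw [Real.norm_of_nonneg (by positivity), ← Real.exp_add, ← Real.exp_add, Real.exp_le_exp]
    have h1 := sq_div_four_le_sq_inv_mul_sinh hh.1 u
    have h2 : h ^ 2 * ν ^ 2 ≤ ν ^ 2 :=
      mul_le_of_le_one_left (sq_nonneg ν) (pow_le_one₀ hh.1.le hh.2.le)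
    nlinarith [sq_nonneg (h * ν + u / 2)]
  · exact (integrable_exp_neg_mul_sq (by norm_num)).const_mul _
  · refine Eventually.of_forall fun u => ?_
    have h1 : Tendsto (fun h : ℝ => Real.exp (-ν * (h * u))) (𝓝[>] 0) (𝓝 1) := by
      have : Continuous fun h : ℝ => Real.exp (-ν * (h * u)) := by fun_prop
      simpa using (this.tendsto 0).mono_left nhdsWithin_le_nhds
    have h2 := (((tendsto_inv_mul_sinh u).pow 2).const_mul (-2)).rexp
    convert h1.mul h2 using 2
    rw [one_mul]
    congr 1
    ring

/-- The substitution `t = (r / 2) e^{h u}`, where `r h² = 1`. -/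
lemma integral_rpow_mul_exp_mul_exp_eq (ν : ℝ) {r h : ℝ} (hr : 0 < r) (hh : 0 < h)
    (hrh : r * h ^ 2 = 1) :
    ∫ t in Ioi (0 : ℝ), t ^ (-ν - 1) * Real.exp (-r ^ 2 / (4 * t)) * Real.exp (-t) =
      h * (r / 2) ^ (-ν) * Real.exp (-r) * ∫ u : ℝ,
        Real.exp (-ν * (h * u)) * Real.exp (-2 * (h⁻¹ * Real.sinh (h * u / 2)) ^ 2) := by
  have himg : (fun u : ℝ => r / 2 * Real.exp (h * u)) '' univ = Ioi 0 := by
    ext t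
    simp only [image_univ, mem_range, mem_Ioi]
    constructor
    · rintro ⟨u, rfl⟩
      positivity
    · intro ht
      refine ⟨h⁻¹ * Real.log (2 * t / r), ?_⟩
      rw [mul_inv_cancel_left₀ hh.ne', Real.exp_log (by positivity)]
      field_simp
  have hinj : InjOn (fun u : ℝ => r / 2 * Real.exp (h * u)) univ := by
    intro u _ v _ huv
    have := mul_left_cancel₀ (by positivity) huv
    exact mul_left_cancel₀ hh.ne' (Real.exp_injective this)
  have hderiv : ∀ u ∈ univ, HasDerivWithinAt (fun u : ℝ => r / 2 * Real.exp (h * u))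
      (r / 2 * Real.exp (h * u) * h) univ u := fun u _ => by
    have := ((((hasDerivAt_id u).const_mul h).exp).const_mul (r / 2)).hasDerivWithinAt (s := univ)
    simpa [mul_assoc] using this
  rw [← himg, integral_image_eq_integral_abs_deriv_smul MeasurableSet.univ hderiv hinj,
    setIntegral_univ, ← integral_const_mul]
  congr 1
  ext u
  have hs : -r ^ 2 / (4 * (r / 2 * Real.exp (h * u))) + -(r / 2 * Real.exp (h * u)) =
      -r + -2 * (h⁻¹ * Real.sinh (h * u / 2)) ^ 2 := by
    have hr' : h⁻¹ ^ 2 = r := by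
      rw [inv_pow]
      exact inv_eq_of_mul_eq_one_left hrh
    have hc : 2 * Real.sinh (h * u / 2) ^ 2 = Real.cosh (h * u) - 1 := by
      have := Real.cosh_two_mul (h * u / 2)
      rw [Real.cosh_sq, mul_div_cancel₀ _ two_ne_zero] at this
      linarith
    rw [mul_pow, hr', show -2 * (r * Real.sinh (h * u / 2) ^ 2) =
      -r * (2 * Real.sinh (h * u / 2) ^ 2) by ring, hc, Real.cosh_eq, Real.exp_neg]
    field_simp
    ring
  have hp : (r / 2 * Real.exp (h * u)) ^ (-ν - 1) * (r / 2 * Real.exp (h * u)) =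
      (r / 2) ^ (-ν) * Real.exp (-ν * (h * u)) := by
    rw [← Real.rpow_add_one (by positivity), sub_add_cancel,
      Real.mul_rpow (by positivity) (by positivity), ← Real.exp_mul, mul_comm (h * u)]
  rw [smul_eq_mul, abs_of_pos (by positivity), mul_assoc (_ ^ _), ← Real.exp_add, hs,
    Real.exp_add]
  linear_combination (h * Real.exp (-r) *
    Real.exp (-2 * (h⁻¹ * Real.sinh (h * u / 2)) ^ 2)) * hp

/-- `lim_{|z| → ∞} |z|^{(N+1)/2} e^{|z|} J_log(z) = (2π)^{−(N−1)/2}`. -/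
theorem tendsto_Jlog_atTop (N : ℕ) (hN : 1 ≤ N) :
    Filter.Tendsto
      (fun z : EuclideanSpace ℝ (Fin N) =>
        ‖z‖ ^ (((N : ℝ) + 1) / 2) * Real.exp ‖z‖ * Jlog N z)
      (Filter.comap (fun z : EuclideanSpace ℝ (Fin N) => ‖z‖) Filter.atTop)
      (nhds ((2 * Real.pi) ^ (-((N : ℝ) - 1) / 2))) := by
  have hpi := Real.pi_pos
  have hsqrt : Tendsto (fun r : ℝ => (Real.sqrt r)⁻¹) atTop (𝓝[>] 0) :=
    tendsto_inv_atTop_nhdsGT_zero.comp Real.tendsto_sqrt_atTop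
  have hlim := (((tendsto_integral_exp_mul_exp_sinh ((N : ℝ) / 2)).comp hsqrt).const_mul
    ((2 * Real.pi) ^ (-(N : ℝ) / 2))).comp
      (tendsto_comap (f := fun z : EuclideanSpace ℝ (Fin N) => ‖z‖) (x := atTop))
  have hconst : (2 * Real.pi) ^ (-(N : ℝ) / 2) * Real.sqrt (2 * Real.pi) =
      (2 * Real.pi) ^ (-((N : ℝ) - 1) / 2) := by
    rw [Real.sqrt_eq_rpow, ← Real.rpow_add (by positivity)]
    congr 1
    ring
  rw [hconst] at hlim
  refine hlim.congr' ?_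
  filter_upwards [tendsto_comap.eventually (eventually_gt_atTop (0 : ℝ))] with z hz
  have hr : (0 : ℝ) < Real.sqrt ‖z‖ := Real.sqrt_pos.2 hz
  have hI := integral_rpow_mul_exp_mul_exp_eq ((N : ℝ) / 2) hz (inv_pos.2 hr)
    (by rw [inv_pow, Real.sq_sqrt hz.le, mul_inv_cancel₀ hz.ne'])
  simp only [Function.comp_apply]
  rw [Jlog, neg_div, hI]
  have hpow : ‖z‖ ^ (((N : ℝ) + 1) / 2) = ‖z‖ ^ ((N : ℝ) / 2) * Real.sqrt ‖z‖ := by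
    rw [Real.sqrt_eq_rpow, ← Real.rpow_add hz]
    congr 1
    ring
  have hcancel : ‖z‖ ^ ((N : ℝ) / 2) * ((4 * Real.pi) ^ (-((N : ℝ) / 2)) *
      (‖z‖ / 2) ^ (-((N : ℝ) / 2))) = (2 * Real.pi) ^ (-((N : ℝ) / 2)) := by
    rw [← Real.mul_rpow (by positivity) (by positivity),
      show 4 * Real.pi * (‖z‖ / 2) = ‖z‖ * (2 * Real.pi) by ring,
      Real.mul_rpow hz.le (by positivity), ← mul_assoc, ← Real.rpow_add hz, add_neg_cancel,
      Real.rpow_zero, one_mul]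
  have hexp : Real.exp ‖z‖ * Real.exp (-‖z‖) = 1 := by
    rw [← Real.exp_add, add_neg_cancel, Real.exp_zero]
  rw [hpow, ← hcancel]
  generalize (∫ u : ℝ, Real.exp (-((N : ℝ) / 2) * ((Real.sqrt ‖z‖)⁻¹ * u)) * _) = G
  calc _ = ‖z‖ ^ ((N : ℝ) / 2) * ((4 * Real.pi) ^ (-((N : ℝ) / 2)) *
        (‖z‖ / 2) ^ (-((N : ℝ) / 2))) * G * (Real.sqrt ‖z‖ * (Real.sqrt ‖z‖)⁻¹) *
        (Real.exp ‖z‖ * Real.exp (-‖z‖)) := by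
          rw [hexp, mul_inv_cancel₀ hr.ne', mul_one, mul_one]
    _ = _ := by ring
end

section
/- Let N ≥ 1 and 0 < t < N/2, and let H_t(x) = (4π)^{−N/2} Γ(t)^{−1} ∫₀^∞ s^{t − N/2 − 1} e^{−s} e^{−|x|²/(4s)} ds. Then the weak L^{N/(N−2t)} quasinorm of H_t is exactly ‖H_t‖_{N/(N−2t),∞} = (ω_{N−1}/N)^{(N−2t)/N} · Γ(N/2 − t)/(4^t π^{N/2} Γ(t)), where ω_{N−1} is the surface measure of the unit sphere S^{N−1} ⊂ ℝ^N. -/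
open MeasureTheory
open scoped ENNReal

/-- The Bessel heat kernel `H_t`, the fundamental solution of
`∂_t u + log(I−Δ) u = 0` on `ℝ^N`. -/
noncomputable def Hker (N : ℕ) (t : ℝ) (x : EuclideanSpace ℝ (Fin N)) : ℝ :=
  (4 * Real.pi) ^ (-(N : ℝ) / 2) * (Real.Gamma t)⁻¹ *
    ∫ s in Set.Ioi (0 : ℝ),
      s ^ (t - (N : ℝ) / 2 - 1) * Real.exp (-s) * Real.exp (-‖x‖ ^ 2 / (4 * s))

/-- The weak `L^p` quasinorm `‖f‖_{p,∞} = sup_{λ>0} λ · |{x : |f(x)| > λ}|^{1/p}`. -/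
noncomputable def weakLpNorm (N : ℕ) (p : ℝ) (f : EuclideanSpace ℝ (Fin N) → ℝ) : ℝ≥0∞ :=
  ⨆ l ∈ Set.Ioi (0 : ℝ), ENNReal.ofReal l * (volume {x | l < |f x|}) ^ (1 / p)

/-- `ω_{N−1}`, the surface measure of the unit sphere `S^{N−1} ⊂ ℝ^N`. -/
noncomputable def unitSphereSurface (N : ℕ) : ℝ :=
  ((volume : Measure (EuclideanSpace ℝ (Fin N))).toSphere Set.univ).toReal

/-- The normalized profile of the Bessel kernel: `H_t(x)` is a multiple of
`‖x‖ ^ (-2 a) * besselProfile a (‖x‖² / 4)` with `a = N / 2 - t`. -/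
noncomputable def besselProfile (a b : ℝ) : ℝ :=
  ∫ v in Set.Ioi (0 : ℝ), Real.exp (-v) * v ^ (a - 1) * Real.exp (-b / v)

theorem integrableOn_besselProfile {a b : ℝ} (ha : 0 < a) (hb : 0 ≤ b) :
    IntegrableOn (fun v : ℝ => Real.exp (-v) * v ^ (a - 1) * Real.exp (-b / v))
      (Set.Ioi 0) := by
  refine (Real.GammaIntegral_convergent ha).mono' (by fun_prop) ?_
  filter_upwards [ae_restrict_mem measurableSet_Ioi] with v (hv : 0 < v)
  rw [Real.norm_of_nonneg (by positivity)]
  refine mul_le_of_le_one_right (by positivity) (Real.exp_le_one_iff.2 ?_)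
  rw [neg_div]
  exact neg_nonpos.2 (by positivity)

theorem besselProfile_zero {a : ℝ} (ha : 0 < a) : besselProfile a 0 = Real.Gamma a := by
  simp [besselProfile, Real.Gamma_eq_integral ha]

theorem besselProfile_nonneg (a b : ℝ) : 0 ≤ besselProfile a b := by
  refine setIntegral_nonneg measurableSet_Ioi fun v (hv : 0 < v) => ?_
  positivity

theorem besselProfile_anti {a b c : ℝ} (ha : 0 < a) (hb : 0 ≤ b) (hbc : b ≤ c) :
    besselProfile a c ≤ besselProfile a b := by
  refine setIntegral_mono_on (integrableOn_besselProfile ha (hb.trans hbc))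
    (integrableOn_besselProfile ha hb) measurableSet_Ioi fun v (hv : 0 < v) => ?_
  gcongr

theorem besselProfile_pos {a b : ℝ} (ha : 0 < a) (hb : 0 ≤ b) : 0 < besselProfile a b := by
  refine (setIntegral_pos_iff_support_of_nonneg_ae ?_ (integrableOn_besselProfile ha hb)).2 ?_
  · filter_upwards [ae_restrict_mem measurableSet_Ioi] with v (hv : 0 < v)
    simp only [Pi.zero_apply]
    positivity
  · rw [Set.inter_eq_right.2]
    · simp
    · intro v (hv : 0 < v)
      exact (show 0 < Real.exp (-v) * v ^ (a - 1) * Real.exp (-b / v) by positivity).ne'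

theorem tendsto_besselProfile {a : ℝ} (ha : 0 < a) :
    Filter.Tendsto (besselProfile a) (nhdsWithin 0 (Set.Ioi 0)) (nhds (Real.Gamma a)) := by
  rw [← besselProfile_zero ha]
  refine tendsto_integral_filter_of_dominated_convergence
    (fun v => Real.exp (-v) * v ^ (a - 1)) ?_ ?_ (Real.GammaIntegral_convergent ha) ?_
  · exact Filter.Eventually.of_forall fun b => by fun_prop
  · filter_upwards [self_mem_nhdsWithin] with b (hb : 0 < b)
    filter_upwards [ae_restrict_mem measurableSet_Ioi] with v (hv : 0 < v)
    rw [Real.norm_of_nonneg (by positivity)]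
    refine mul_le_of_le_one_right (by positivity) (Real.exp_le_one_iff.2 ?_)
    rw [neg_div]
    exact neg_nonpos.2 (by positivity)
  · refine Filter.Eventually.of_forall fun v => ?_
    exact Filter.Tendsto.mono_left (Continuous.tendsto (by fun_prop) 0) nhdsWithin_le_nhds

/-- The substitution `s = b / v` in the integral defining the Bessel kernel. -/
theorem integral_bessel_eq {a b : ℝ} (hb : 0 < b) :
    ∫ s in Set.Ioi (0 : ℝ), s ^ (-a - 1) * Real.exp (-s) * Real.exp (-b / s)
      = b ^ (-a) * besselProfile a b := by
  set g : ℝ → ℝ := fun s => s ^ (-a - 1) * Real.exp (-s) * Real.exp (-b / s) with hg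
  have h1 := integral_comp_mul_left_Ioi g 0 hb
  rw [← integral_comp_rpow_Ioi (fun x => g (b * x)) (show (-1 : ℝ) ≠ 0 by norm_num),
    mul_zero, smul_eq_mul, eq_inv_mul_iff_mul_eq₀ hb.ne'] at h1
  rw [← h1, besselProfile, ← integral_const_mul, ← integral_const_mul]
  refine setIntegral_congr_fun measurableSet_Ioi fun v (hv : 0 < v) => ?_
  have e1 : -(b * v⁻¹) = -b / v := by ring
  have e2 : -b / (b * v⁻¹) = -v := by field_simp
  have e3 : (b * v⁻¹) ^ (-a - 1) = b ^ (-a) * b⁻¹ * (v ^ (a - 1) * v ^ (2 : ℝ)) := by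
    rw [Real.mul_rpow hb.le (by positivity), Real.inv_rpow hv.le, ← Real.rpow_neg hv.le,
      ← Real.rpow_add hv, Real.rpow_sub_one hb.ne', div_eq_mul_inv]
    ring_nf
  have e4 : v ^ (-1 - 1 : ℝ) = (v ^ (2 : ℝ))⁻¹ := by
    rw [← Real.rpow_neg hv.le]; norm_num
  have hv2 : v ^ (2 : ℝ) ≠ 0 := (Real.rpow_pos_of_pos hv _).ne'
  simp only [hg, Real.rpow_neg_one, smul_eq_mul, e1, e2, e3, e4, abs_neg, abs_one, one_mul]
  field_simp

/-- The Bessel kernel away from the origin, in terms of the profile. -/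
theorem Hker_eq_besselProfile (N : ℕ) (t : ℝ) {x : EuclideanSpace ℝ (Fin N)} (hx : x ≠ 0) :
    Hker N t x = ((4 : ℝ) ^ t * Real.pi ^ ((N : ℝ) / 2) * Real.Gamma t)⁻¹ *
      (‖x‖ ^ (-((N : ℝ) - 2 * t)) * besselProfile ((N : ℝ) / 2 - t) (‖x‖ ^ 2 / 4)) := by
  have hr : 0 < ‖x‖ := norm_pos_iff.2 hx
  have hint := integral_bessel_eq (a := (N : ℝ) / 2 - t) (b := ‖x‖ ^ 2 / 4) (by positivity)
  have hcongr : ∫ s in Set.Ioi (0 : ℝ),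
      s ^ (t - (N : ℝ) / 2 - 1) * Real.exp (-s) * Real.exp (-‖x‖ ^ 2 / (4 * s))
      = (‖x‖ ^ 2 / 4) ^ (-((N : ℝ) / 2 - t)) *
        besselProfile ((N : ℝ) / 2 - t) (‖x‖ ^ 2 / 4) := by
    rw [← hint]
    congr 1 with s
    rw [show -((N : ℝ) / 2 - t) - 1 = t - (N : ℝ) / 2 - 1 by ring,
      show -(‖x‖ ^ 2 / 4) / s = -‖x‖ ^ 2 / (4 * s) by ring]
  have hpow : (‖x‖ ^ 2 / 4) ^ (-((N : ℝ) / 2 - t))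
      = ‖x‖ ^ (-((N : ℝ) - 2 * t)) * (4 ^ ((N : ℝ) / 2) * ((4 : ℝ) ^ t)⁻¹) := by
    rw [Real.div_rpow (by positivity) (by norm_num), ← Real.rpow_natCast,
      ← Real.rpow_mul hr.le, Real.rpow_neg (by norm_num : (0 : ℝ) ≤ 4), div_inv_eq_mul,
      Real.rpow_sub (by norm_num), div_eq_mul_inv]
    congr 2
    push_cast
    ring
  rw [Hker, hcongr, hpow, neg_div, Real.rpow_neg (by positivity),
    Real.mul_rpow (by norm_num) Real.pi_pos.le]
  have : (4 : ℝ) ^ ((N : ℝ) / 2) ≠ 0 := (by positivity : (0 : ℝ) < _).ne'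
  field_simp

theorem volume_ball_eq_unitSphereSurface {N : ℕ} (hN : 1 ≤ N) {r : ℝ} (hr : 0 ≤ r) :
    volume (Metric.ball (0 : EuclideanSpace ℝ (Fin N)) r)
      = ENNReal.ofReal (r ^ (N : ℝ) * (unitSphereSurface N / N)) := by
  have : Nonempty (Fin N) := ⟨⟨0, hN⟩⟩
  have hN0 : (N : ℝ) ≠ 0 := by positivity
  have h : unitSphereSurface N / N
      = (volume (Metric.ball (0 : EuclideanSpace ℝ (Fin N)) 1)).toReal := by
    rw [unitSphereSurface, Measure.toSphere_apply_univ]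
    simp [hN0]
  rw [h, ENNReal.ofReal_mul (by positivity), ENNReal.ofReal_toReal measure_ball_lt_top.ne,
    Measure.addHaar_ball _ _ hr, Real.rpow_natCast]
  simp

/-- A ball whose radius solves `K * r ^ (-d) = l` contributes `K * |B| ^ (d / N)` to the weak norm
of a function with decay `‖x‖ ^ (-d)`. -/
theorem ofReal_mul_volume_ball_rpow {N : ℕ} (hN : 1 ≤ N) {d K r : ℝ} (hd : 0 < d)
    (hK : 0 ≤ K) (hr : 0 < r) :
    ENNReal.ofReal (K * r ^ (-d)) *
        volume (Metric.ball (0 : EuclideanSpace ℝ (Fin N)) r) ^ (1 / ((N : ℝ) / d))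
      = ENNReal.ofReal ((unitSphereSurface N / N) ^ (d / N) * K) := by
  have hN0 : (N : ℝ) ≠ 0 := by positivity
  have hS : 0 ≤ unitSphereSurface N / N := by
    unfold unitSphereSurface
    positivity
  rw [volume_ball_eq_unitSphereSurface hN hr.le, one_div_div,
    ENNReal.ofReal_rpow_of_nonneg (by positivity) (by positivity),
    ← ENNReal.ofReal_mul (by positivity), Real.mul_rpow (by positivity) hS,
    ← Real.rpow_mul hr.le, mul_div_cancel₀ _ hN0, Real.rpow_neg hr.le]
  have : r ^ d ≠ 0 := (Real.rpow_pos_of_pos hr d).ne'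
  congr 1
  field_simp

/-- For `N ≥ 1` and `0 < t < N/2`, the weak `L^{N/(N−2t)}` quasinorm of the Bessel
kernel `H_t` is exactly
`(ω_{N−1}/N)^{(N−2t)/N} · Γ(N/2 − t)/(4^t π^{N/2} Γ(t))`. -/
theorem weakLpNorm_Hker (N : ℕ) (hN : 1 ≤ N) (t : ℝ) (ht : 0 < t)
    (htN : t < (N : ℝ) / 2) :
    weakLpNorm N ((N : ℝ) / ((N : ℝ) - 2 * t)) (Hker N t)
      = ENNReal.ofReal
          ((unitSphereSurface N / N) ^ (((N : ℝ) - 2 * t) / N) *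
            (Real.Gamma ((N : ℝ) / 2 - t) /
              ((4 : ℝ) ^ t * Real.pi ^ ((N : ℝ) / 2) * Real.Gamma t))) := by
  have : Nonempty (Fin N) := ⟨⟨0, hN⟩⟩
  have hd : 0 < (N : ℝ) - 2 * t := by linarith
  have ha : 0 < (N : ℝ) / 2 - t := by linarith
  have hΓ : 0 < Real.Gamma t := Real.Gamma_pos_of_pos ht
  have hΓa : 0 < Real.Gamma ((N : ℝ) / 2 - t) := Real.Gamma_pos_of_pos ha
  have hC : 0 < ((4 : ℝ) ^ t * Real.pi ^ ((N : ℝ) / 2) * Real.Gamma t)⁻¹ := by positivity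
  have hH := fun x hx => Hker_eq_besselProfile N t (x := x) hx
  rw [div_eq_mul_inv (Real.Gamma _), mul_comm (Real.Gamma _)]
  generalize ((4 : ℝ) ^ t * Real.pi ^ ((N : ℝ) / 2) * Real.Gamma t)⁻¹ = C at hH hC ⊢
  generalize (N : ℝ) / 2 - t = a at ha hΓa hH ⊢
  generalize (N : ℝ) - 2 * t = d at hd hH ⊢
  apply le_antisymm
  · refine iSup₂_le fun l (hl : 0 < l) => ?_
    set K := C * Real.Gamma a with hK
    have hKpos : 0 < K := by positivity
    have hr : 0 < (K / l) ^ d⁻¹ := by positivity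
    have hlK : l = K * ((K / l) ^ d⁻¹) ^ (-d) := by
      rw [Real.rpow_neg hr.le, ← Real.rpow_mul (by positivity), inv_mul_cancel₀ hd.ne',
        Real.rpow_one]
      field_simp
    rw [← ofReal_mul_volume_ball_rpow hN hd hKpos.le hr, ← hlK]
    gcongr
    intro x (hx : l < |Hker N t x|)
    rw [mem_ball_zero_iff]
    by_contra! hxr
    have hx0 : 0 < ‖x‖ := hr.trans_le hxr
    rw [hH x (norm_pos_iff.1 hx0), abs_of_nonneg
      (mul_nonneg hC.le (mul_nonneg (by positivity) (besselProfile_nonneg _ _)))] at hx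
    refine hx.not_ge ?_
    calc C * (‖x‖ ^ (-d) * besselProfile a (‖x‖ ^ 2 / 4))
        ≤ C * (((K / l) ^ d⁻¹) ^ (-d) * Real.Gamma a) := by
          refine mul_le_mul_of_nonneg_left (mul_le_mul
            (Real.rpow_le_rpow_of_nonpos hr hxr (by linarith)) ?_
            (besselProfile_nonneg _ _) (by positivity)) hC.le
          rw [← besselProfile_zero ha]
          exact besselProfile_anti ha le_rfl (by positivity)
      _ = K * ((K / l) ^ d⁻¹) ^ (-d) := by rw [hK]; ring
      _ = l := hlK.symm
  · have hbound : ∀ b : ℝ, 0 < b →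
        ENNReal.ofReal ((unitSphereSurface N / N) ^ (d / N) * (C * besselProfile a b))
          ≤ weakLpNorm N ((N : ℝ) / d) (Hker N t) := by
      intro b hb
      have hG := besselProfile_pos ha hb.le
      have hr : 0 < 2 * √b := by positivity
      rw [← ofReal_mul_volume_ball_rpow hN hd (mul_pos hC hG).le hr]
      refine le_trans ?_ (le_iSup₂ (α := ℝ≥0∞) (C * besselProfile a b * (2 * √b) ^ (-d))
        (show 0 < C * besselProfile a b * (2 * √b) ^ (-d) by positivity))
      rw [← measure_sdiff_null (s := Metric.ball _ _)
        (measure_singleton (0 : EuclideanSpace ℝ (Fin N)))]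
      gcongr
      rintro x ⟨hx, hx0 : x ≠ 0⟩
      rw [mem_ball_zero_iff] at hx
      have hxpos := norm_pos_iff.2 hx0
      have hxb : ‖x‖ ^ 2 / 4 ≤ b := by
        nlinarith [Real.sq_sqrt hb.le]
      refine lt_of_lt_of_le ?_ (le_abs_self (Hker N t x))
      rw [hH x hx0]
      calc C * besselProfile a b * (2 * √b) ^ (-d)
          < C * besselProfile a b * ‖x‖ ^ (-d) :=
            mul_lt_mul_of_pos_left (Real.rpow_lt_rpow_of_neg hxpos hx (by linarith))
              (mul_pos hC hG)
        _ = C * (‖x‖ ^ (-d) * besselProfile a b) := by ring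
        _ ≤ C * (‖x‖ ^ (-d) * besselProfile a (‖x‖ ^ 2 / 4)) := by
            gcongr
            exact besselProfile_anti ha (by positivity) hxb
    refine le_of_tendsto (f := fun b => ENNReal.ofReal
      ((unitSphereSurface N / N) ^ (d / N) * (C * besselProfile a b)))
      (x := nhdsWithin 0 (Set.Ioi 0)) ?_ ?_
    · exact (ENNReal.continuous_ofReal.tendsto _).comp
        (((tendsto_besselProfile ha).const_mul C).const_mul _)
    · filter_upwards [self_mem_nhdsWithin] with b hb using hbound b hb
end
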